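/- Let 1 < p < ∞ and let W₀ : M^{3×2} → [0,+∞] be continuous as an extended-valued function and p-coercive, with W₀(A) = +∞ if and only if A¹ ∧ A² = 0, and such that for every δ > 0 there exists c_δ > 0 with W₀(A) ≤ c_δ(1 + |A|^p) whenever |A¹ ∧ A²| ≥ δ. Let V ⊂ ℝ² be a bounded open set with ℒ²(∂V) = 0, let A ∈ M^{3×2} with rank(A) = 2, and let i ≥ 0. Then there exists a family {φ_{n,l,q}}_{n,l,q ≥ 1} ⊂ Aff_c(V, ℝ³) such that: (i) for every l, q ≥ 1, φ_{n,l,q} → 0 in L^p(V, ℝ³) as n → ∞; (ii) for every n, l, q ≥ 1 and every c ∈ ℝ³, the map x ↦ Ax + c + φ_{n,l,q}(x) belongs to Aff*(V, ℝ³); (iii) limsup_{q→∞} limsup_{l→∞} limsup_{n→∞} ∫_V R_iW₀(∇φ_{n,l,q}(x) + A) dx ≤ ℒ²(V) · R_{i+1}W₀(A), where ∇φ_{n,l,q} denotes the a.e. defined gradient. -/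

import Mathlib

open Filter MeasureTheory Set
open scoped ENNReal

noncomputable section

/-- `v` is piecewise affine on `U`: continuous on `U` and affine on each element of a finite
family of pairwise disjoint open subsets of `U` covering `U` up to a Lebesgue-null set. -/
def PiecewiseAffineOn {E F : Type*} [NormedAddCommGroup E] [NormedSpace ℝ E]
    [MeasureSpace E] [NormedAddCommGroup F] [NormedSpace ℝ F]
    (v : E → F) (U : Set E) : Prop :=
  ContinuousOn v U ∧
  ∃ (N : ℕ) (V : Fin N → Set E),
    (∀ i, IsOpen (V i)) ∧ (∀ i, V i ⊆ U) ∧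
    (∀ i j, i ≠ j → Disjoint (V i) (V j)) ∧
    volume (U \ ⋃ i, V i) = 0 ∧
    ∀ i, ∃ (L : E →L[ℝ] F) (c : F), ∀ x ∈ V i, v x = L x + c

/-- The Clarke subdifferential of `f` at `x`: the convex hull of all limits of derivatives
`fderiv ℝ f xₖ` along sequences `xₖ → x` of points of differentiability. -/
def clarkeSubdiff {E F : Type*} [NormedAddCommGroup E] [NormedSpace ℝ E]
    [NormedAddCommGroup F] [NormedSpace ℝ F] (f : E → F) (x : E) : Set (E →L[ℝ] F) :=
  convexHull ℝ {A | ∃ u : ℕ → E, Tendsto u atTop (nhds x) ∧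
    (∀ k, DifferentiableAt ℝ f (u k)) ∧ Tendsto (fun k => fderiv ℝ f (u k)) atTop (nhds A)}

/-- The matrix of a continuous linear map. -/
def clmMat {n m : ℕ} (A : EuclideanSpace ℝ (Fin n) →L[ℝ] (Fin m → ℝ)) :
    Matrix (Fin m) (Fin n) ℝ :=
  Matrix.of fun i j => A (EuclideanSpace.single j 1) i

/-- The Jacobian matrix of `f` at `x` (junk value where `f` is not differentiable). -/
def jacMat {n m : ℕ} (f : EuclideanSpace ℝ (Fin n) → (Fin m → ℝ)) (x : EuclideanSpace ℝ (Fin n)) :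
    Matrix (Fin m) (Fin n) ℝ := clmMat (fderiv ℝ f x)

/-- Frobenius norm of a matrix. -/
noncomputable def mnorm {k l : ℕ} (A : Matrix (Fin k) (Fin l) ℝ) : ℝ :=
  Real.sqrt (∑ i, ∑ j, A i j ^ 2)

/-- Euclidean norm of a vector given as a plain function. -/
noncomputable def vnorm {k : ℕ} (x : Fin k → ℝ) : ℝ :=
  Real.sqrt (∑ i, x i ^ 2)

/-- `D` is an open set which, near each boundary point and in suitable orthonormal
coordinates, coincides locally with the region strictly above the graph of a
Lipschitz function. -/
def IsLipschitzGraphDomain {m : ℕ} (D : Set (EuclideanSpace ℝ (Fin (m+1)))) : Prop :=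
  IsOpen D ∧ ∀ z ∈ frontier D,
    ∃ (b : OrthonormalBasis (Fin (m+1)) ℝ (EuclideanSpace ℝ (Fin (m+1))))
      (K : NNReal) (f : (Fin m → ℝ) → ℝ) (r : ℝ), 0 < r ∧ LipschitzWith K f ∧
      ∀ x ∈ Metric.ball z r,
        (x ∈ D ↔ f (fun i => b.repr x i.castSucc) < b.repr x (Fin.last m))

/-- `Aff*`: piecewise affine maps with maximal-rank constraint: for `n < m`, the Clarke
subgradients `A` satisfy `det (Aᵀ A) ≥ η > 0` uniformly; for `n = m`, `det ∇v > 0` a.e. -/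
def AffStar {n m : ℕ} (v : EuclideanSpace ℝ (Fin n) → (Fin m → ℝ))
    (Ω : Set (EuclideanSpace ℝ (Fin n))) : Prop :=
  PiecewiseAffineOn v Ω ∧
  ((n < m ∧ ∃ η > (0:ℝ), ∀ x ∈ Ω, ∀ A ∈ clarkeSubdiff v x,
      η ≤ ((clmMat A).transpose * clmMat A).det) ∨
   (∃ h : n = m, ∀ᵐ x ∂(volume.restrict Ω), DifferentiableAt ℝ v x ∧
      0 < ((jacMat v x).submatrix (finCongr h) id).det))

/-- Cross product in ℝ³. -/
def cross3 (u v : Fin 3 → ℝ) : Fin 3 → ℝ :=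
  ![u 1 * v 2 - u 2 * v 1, u 2 * v 0 - u 0 * v 2, u 0 * v 1 - u 1 * v 0]

/-- The 3×3 matrix `(A|ζ)` whose first two columns are those of `A` and last column is `ζ`. -/
def aug (A : Matrix (Fin 3) (Fin 2) ℝ) (ζ : Fin 3 → ℝ) : Matrix (Fin 3) (Fin 3) ℝ :=
  Matrix.of fun i j => if h : (j : ℕ) < 2 then A i ⟨j, h⟩ else ζ i

/-- The cross product `A¹ ∧ A²` of the two columns of `A`. -/
def crossCols (A : Matrix (Fin 3) (Fin 2) ℝ) : Fin 3 → ℝ :=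
  cross3 (fun i => A i 0) (fun i => A i 1)

/-- The reduced energy density `W₀(A) := inf_ζ W(A|ζ)`. -/
noncomputable def W0fun (W : Matrix (Fin 3) (Fin 3) ℝ → ℝ≥0∞) :
    Matrix (Fin 3) (Fin 2) ℝ → ℝ≥0∞ :=
  fun A => ⨅ ζ : Fin 3 → ℝ, W (aug A ζ)

/-- Rank-one convexity for extended-valued functions on 3×2 matrices. -/
def RankOneConvexENN (f : Matrix (Fin 3) (Fin 2) ℝ → ℝ≥0∞) : Prop :=
  ∀ (ξ ξ' : Matrix (Fin 3) (Fin 2) ℝ) (lam : ℝ), lam ∈ Set.Ioo (0:ℝ) 1 →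
    (ξ - ξ').rank = 1 →
    f (lam • ξ + (1 - lam) • ξ') ≤ ENNReal.ofReal lam * f ξ + ENNReal.ofReal (1 - lam) * f ξ'

/-- The rank-one convex envelope: the greatest rank-one convex function below `f`,
realized as the pointwise supremum of all rank-one convex functions below `f`. -/
noncomputable def rankOneEnv (f : Matrix (Fin 3) (Fin 2) ℝ → ℝ≥0∞) :
    Matrix (Fin 3) (Fin 2) ℝ → ℝ≥0∞ :=
  fun A => ⨆ g ∈ {g : Matrix (Fin 3) (Fin 2) ℝ → ℝ≥0∞ |
    RankOneConvexENN g ∧ ∀ B, g B ≤ f B}, g A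

/-- The Kohn–Strang iterative scheme for the rank-one convex envelope. -/
noncomputable def RIter (f : Matrix (Fin 3) (Fin 2) ℝ → ℝ≥0∞) :
    ℕ → Matrix (Fin 3) (Fin 2) ℝ → ℝ≥0∞
  | 0 => f
  | (i+1) => fun A =>
      ⨅ (a : Fin 2 → ℝ) (b : Fin 3 → ℝ) (lam : ℝ) (_ : lam ∈ Set.Icc (0:ℝ) 1),
        ENNReal.ofReal (1 - lam) * RIter f i (A - lam • Matrix.vecMulVec b a) +
        ENNReal.ofReal lam * RIter f i (A + (1 - lam) • Matrix.vecMulVec b a)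

abbrev E2 := EuclideanSpace ℝ (Fin 2)

lemma RIter_succ_le (f : Matrix (Fin 3) (Fin 2) ℝ → ℝ≥0∞) (i : ℕ) (A) :
    RIter f (i+1) A ≤ RIter f i A := by
  show (⨅ (a : Fin 2 → ℝ) (b : Fin 3 → ℝ) (lam : ℝ) (_ : lam ∈ Set.Icc (0:ℝ) 1), _) ≤ _
  refine iInf_le_of_le 0 (iInf_le_of_le 0 (iInf_le_of_le 0 (iInf_le_of_le (by simp) ?_)))
  simp

lemma RIter_le (f : Matrix (Fin 3) (Fin 2) ℝ → ℝ≥0∞) (i : ℕ) (A) :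
    RIter f i A ≤ f A := by
  induction i with
  | zero => exact le_rfl
  | succ k ih => exact (RIter_succ_le f k A).trans ih

lemma RIter_usc (f : Matrix (Fin 3) (Fin 2) ℝ → ℝ≥0∞) (hf : Continuous f) (i : ℕ) :
    UpperSemicontinuous (RIter f i) := by
  induction i with
  | zero => exact hf.upperSemicontinuous
  | succ k ih =>
    show UpperSemicontinuous (fun A => ⨅ (a : Fin 2 → ℝ) (b : Fin 3 → ℝ) (lam : ℝ)
      (_ : lam ∈ Set.Icc (0:ℝ) 1), _)
    refine upperSemicontinuous_iInf fun a => upperSemicontinuous_iInf fun b =>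
      upperSemicontinuous_iInf fun lam => upperSemicontinuous_iInf fun _ => ?_
    refine UpperSemicontinuous.add ?_ ?_
    · refine (ENNReal.continuous_const_mul ENNReal.ofReal_ne_top).comp_upperSemicontinuous
        (ih.comp (g := fun A => A - lam • Matrix.vecMulVec b a) (by fun_prop))
        (fun x y h => mul_le_mul_right h _)
    · refine (ENNReal.continuous_const_mul ENNReal.ofReal_ne_top).comp_upperSemicontinuous
        (ih.comp (g := fun A => A + (1 - lam) • Matrix.vecMulVec b a) (by fun_prop))
        (fun x y h => mul_le_mul_right h _)

lemma crossCols_ne (A : Matrix (Fin 3) (Fin 2) ℝ) (hA : A.rank = 2) : crossCols A ≠ 0 := by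
  intro h
  have hli : LinearIndependent ℝ A.col := by
    rw [linearIndependent_iff_card_eq_finrank_span, Set.finrank,
      ← Matrix.rank_eq_finrank_span_cols, hA]; simp
  rw [Fintype.linearIndependent_iff] at hli
  have e0 := congrFun h 0
  have e1 := congrFun h 1
  have e2 := congrFun h 2
  simp [crossCols, cross3] at e0 e1 e2
  have key : ∀ i, A i 0 = 0 := by
    intro i
    have := hli ![A i 1, -A i 0] (by
      ext j
      fin_cases i <;> fin_cases j <;> simp [Fin.sum_univ_two, Matrix.col_apply] <;> linarith) 1
    simpa using this
  have := hli ![1, 0] (by ext j; simp [Fin.sum_univ_two, Matrix.col_apply, key]) 0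
  simp at this

/-- the triple product -/
def trip (A : Matrix (Fin 3) (Fin 2) ℝ) (b : Fin 3 → ℝ) : ℝ := ∑ i, crossCols A i * b i

lemma trip_add (A : Matrix (Fin 3) (Fin 2) ℝ) (b : Fin 3 → ℝ) (w : Fin 2 → ℝ) :
    trip (A + Matrix.vecMulVec b w) b = trip A b := by
  simp [trip, crossCols, cross3, Fin.sum_univ_three, Matrix.vecMulVec_apply]; ring

lemma det_ge (M : Matrix (Fin 3) (Fin 2) ℝ) (b : Fin 3 → ℝ) :
    trip M b ^ 2 ≤ (M.transpose * M).det * ∑ i, b i ^ 2 := by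
  have : (M.transpose * M).det = ∑ i, crossCols M i ^ 2 := by
    simp [Matrix.det_fin_two, Matrix.mul_apply, crossCols, cross3, Fin.sum_univ_three]; ring
  rw [this]
  exact Finset.sum_mul_sq_le_sq_mul_sq _ _ _

lemma exists_good (f : Matrix (Fin 3) (Fin 2) ℝ → ℝ≥0∞) (hf : Continuous f) (i : ℕ)
    (A : Matrix (Fin 3) (Fin 2) ℝ) (hA : crossCols A ≠ 0) (y : ℝ≥0∞) (hy : RIter f (i+1) A < y) :
    ∃ (a : Fin 2 → ℝ) (b : Fin 3 → ℝ) (lam : ℝ), lam ∈ Set.Icc (0:ℝ) 1 ∧ trip A b ≠ 0 ∧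
      ENNReal.ofReal (1 - lam) * RIter f i (A + Matrix.vecMulVec b (-lam • a)) +
        ENNReal.ofReal lam * RIter f i (A + Matrix.vecMulVec b ((1 - lam) • a)) < y := by
  have hy' : (⨅ (a : Fin 2 → ℝ) (b : Fin 3 → ℝ) (lam : ℝ) (_ : lam ∈ Set.Icc (0:ℝ) 1),
        ENNReal.ofReal (1 - lam) * RIter f i (A - lam • Matrix.vecMulVec b a) +
        ENNReal.ofReal lam * RIter f i (A + (1 - lam) • Matrix.vecMulVec b a)) < y := hy
  simp only [iInf_lt_iff] at hy'
  obtain ⟨a, b, lam, hl, h⟩ := hy'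
  have hN : 0 < trip A (crossCols A) := by
    unfold trip
    obtain ⟨j, hj⟩ := Function.ne_iff.mp hA
    have : 0 < crossCols A j * crossCols A j := by
      have : crossCols A j ≠ 0 := hj
      exact mul_self_pos.2 this
    exact Finset.sum_pos' (fun i _ => mul_self_nonneg _) ⟨j, Finset.mem_univ _, this⟩
  set F : ℝ → ℝ≥0∞ := fun δ =>
    ENNReal.ofReal (1 - lam) * RIter f i (A + Matrix.vecMulVec (b + δ • crossCols A) (-lam • a)) +
        ENNReal.ofReal lam * RIter f i (A + Matrix.vecMulVec (b + δ • crossCols A) ((1 - lam) • a))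
    with hF
  have hFu : UpperSemicontinuous F := by
    have := RIter_usc f hf i
    refine UpperSemicontinuous.add ?_ ?_
    · refine (ENNReal.continuous_const_mul ENNReal.ofReal_ne_top).comp_upperSemicontinuous
        (this.comp (g := fun δ : ℝ => A + Matrix.vecMulVec (b + δ • crossCols A) (-lam • a))
        (by fun_prop)) (fun x y h => mul_le_mul_right h _)
    · refine (ENNReal.continuous_const_mul ENNReal.ofReal_ne_top).comp_upperSemicontinuous
        (this.comp (g := fun δ : ℝ => A + Matrix.vecMulVec (b + δ • crossCols A) ((1-lam) • a))
        (by fun_prop)) (fun x y h => mul_le_mul_right h _)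
  have h0 : F 0 < y := by
    simpa [hF, Matrix.vecMulVec_smul, sub_eq_add_neg] using h
  have hev := (hFu 0 y h0).filter_mono (nhdsWithin_le_nhds (s := {0}ᶜ))
  have hev2 : ∀ᶠ δ in nhdsWithin (0:ℝ) {0}ᶜ, trip A (b + δ • crossCols A) ≠ 0 := by
    have hexp : ∀ δ : ℝ, trip A (b + δ • crossCols A) = trip A b + δ * trip A (crossCols A) := by
      intro δ; simp [trip, Fin.sum_univ_three]; ring
    by_cases hb : trip A b = 0
    · filter_upwards [self_mem_nhdsWithin] with δ hδ
      rw [hexp, hb, zero_add]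
      exact mul_ne_zero hδ hN.ne'
    · refine Filter.Eventually.filter_mono nhdsWithin_le_nhds ?_
      have hc : Continuous fun δ : ℝ => trip A b + δ * trip A (crossCols A) := by fun_prop
      simp only [hexp]
      exact hc.continuousAt.eventually_ne (by simpa using hb)
  obtain ⟨δ, h1, h2⟩ := (hev.and hev2).exists
  exact ⟨a, b + δ • crossCols A, lam, hl, h2, h1⟩

lemma null_coincide (P Q : (E2 →L[ℝ] ℝ) × ℝ) (h : P ≠ Q) :
    volume {x : E2 | P.1 x + P.2 = Q.1 x + Q.2} = 0 := by
  by_cases h1 : P.1 = Q.1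
  · have : P.2 ≠ Q.2 := fun h2 => h (Prod.ext h1 h2)
    simp [h1, this]
  · rcases Set.eq_empty_or_nonempty {x : E2 | P.1 x + P.2 = Q.1 x + Q.2} with he | ⟨x0, hx0⟩
    · rw [he]; simp
    · have hx0 : P.1 x0 + P.2 = Q.1 x0 + Q.2 := hx0
      have hk := Measure.addHaar_submodule (volume : Measure E2)
        (LinearMap.ker (P.1 - Q.1 : E2 →L[ℝ] ℝ).toLinearMap) (by
          intro ht
          apply h1
          ext x
          have : x ∈ LinearMap.ker (P.1 - Q.1 : E2 →L[ℝ] ℝ).toLinearMap := by rw [ht]; trivial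
          have : P.1 x - Q.1 x = 0 := by simpa using this
          linarith)
      rw [← measure_preimage_add_right volume (-x0)] at hk
      refine measure_mono_null ?_ hk
      intro x hx
      have hx : P.1 x + P.2 = Q.1 x + Q.2 := hx
      simp
      linarith

/-- the open piece where `h` agrees only with `P` -/
def piece (h : E2 → ℝ) (V : Set E2) (T : Set ((E2 →L[ℝ] ℝ) × ℝ)) (P : (E2 →L[ℝ] ℝ) × ℝ) : Set E2 :=
  {x | x ∈ V ∧ ∀ Q ∈ T, Q ≠ P → h x ≠ Q.1 x + Q.2}

lemma piece_open {h : E2 → ℝ} {V : Set E2} {T : Set ((E2 →L[ℝ] ℝ) × ℝ)} (hh : Continuous h)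
    (hV : IsOpen V) (hT : T.Finite) (P) : IsOpen (piece h V T P) := by
  have : piece h V T P = V ∩ ⋂ Q ∈ T, {x | Q ≠ P → h x ≠ Q.1 x + Q.2} := by
    ext x; simp [piece]
  rw [this]
  refine hV.inter (hT.isOpen_biInter fun Q _ => ?_)
  by_cases hQ : Q = P
  · simp [hQ]
  · simp only [ne_eq, hQ, not_false_eq_true, forall_const]
    exact isOpen_ne_fun hh (by fun_prop)

lemma piece_eq {h : E2 → ℝ} {V : Set E2} {T : Set ((E2 →L[ℝ] ℝ) × ℝ)}
    (hs : ∀ x ∈ V, ∃ P ∈ T, h x = P.1 x + P.2) {P} {x} (hx : x ∈ piece h V T P) :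
    h x = P.1 x + P.2 := by
  obtain ⟨Q, hQ, he⟩ := hs x hx.1
  by_cases hQP : Q = P
  · rw [← hQP]; exact he
  · exact absurd he (hx.2 Q hQ hQP)

lemma piece_null {h : E2 → ℝ} {V : Set E2} {T : Set ((E2 →L[ℝ] ℝ) × ℝ)} (hT : T.Finite)
    (hs : ∀ x ∈ V, ∃ P ∈ T, h x = P.1 x + P.2) :
    volume (V \ ⋃ P ∈ T, piece h V T P) = 0 := by
  have : V \ ⋃ P ∈ T, piece h V T P ⊆
      ⋃ P ∈ T, ⋃ Q ∈ T, {x | P ≠ Q ∧ P.1 x + P.2 = Q.1 x + Q.2} := by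
    rintro x ⟨hx, hn⟩
    obtain ⟨P, hP, he⟩ := hs x hx
    simp only [mem_iUnion, not_exists] at hn ⊢
    have := hn P hP
    simp only [piece, mem_ofPred_eq, hx, true_and, not_forall, not_not] at this
    obtain ⟨Q, hQ, hne, he2⟩ := this
    exact ⟨P, hP, Q, hQ, hne.symm, by rw [← he, he2]⟩
  refine measure_mono_null this ?_
  rw [measure_biUnion_null_iff hT.countable]
  intro P _
  rw [measure_biUnion_null_iff hT.countable]
  intro Q _
  by_cases hPQ : P = Q
  · simp [hPQ]
  · simpa [hPQ] using null_coincide P Q hPQ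

lemma sel_pa {h : E2 → ℝ} {V : Set E2} {T : Set ((E2 →L[ℝ] ℝ) × ℝ)} (hh : Continuous h)
    (hV : IsOpen V) (hT : T.Finite)
    (hs : ∀ x ∈ V, ∃ P ∈ T, h x = P.1 x + P.2) (L : E2 →L[ℝ] (Fin 3 → ℝ)) (c b : Fin 3 → ℝ) :
    PiecewiseAffineOn (fun x => L x + c + h x • b) V := by
  refine ⟨by fun_prop, ?_⟩
  let e := hT.toFinset.equivFin.symm
  refine ⟨_, fun i => piece h V T (e i), fun i => piece_open hh hV hT _, fun i x hx => hx.1,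
    ?_, ?_, ?_⟩
  · intro i j hij
    rw [Set.disjoint_left]
    intro x hx hy
    have := piece_eq hs hx
    refine hy.2 (e i) ((hT.mem_toFinset).1 (e i).2) ?_ this
    intro he
    exact hij (e.injective (Subtype.ext he))
  · convert piece_null hT hs using 3
    ext x
    simp only [mem_iUnion]
    constructor
    · rintro ⟨i, hi⟩
      exact ⟨_, (hT.mem_toFinset).1 (e i).2, hi⟩
    · rintro ⟨P, hP, hx⟩
      refine ⟨e.symm ⟨P, (hT.mem_toFinset).2 hP⟩, ?_⟩
      simpa using hx
  · intro i
    refine ⟨L + (e i).1.1.smulRight b, c + (e i).1.2 • b, fun x hx => ?_⟩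
    have := piece_eq hs hx
    simp only [this]
    simp [add_smul]
    abel

lemma sel_ae {h : E2 → ℝ} {V : Set E2} {T : Set ((E2 →L[ℝ] ℝ) × ℝ)} (hh : Continuous h)
    (hV : IsOpen V) (hT : T.Finite)
    (hs : ∀ x ∈ V, ∃ P ∈ T, h x = P.1 x + P.2) :
    ∀ᵐ x ∂(volume.restrict V), ∀ P ∈ T, h x = P.1 x + P.2 → HasFDerivAt h P.1 x := by
  have h0 := piece_null hT hs
  rw [ae_restrict_iff' hV.measurableSet]
  have : ∀ᵐ x, x ∉ V \ ⋃ P ∈ T, piece h V T P := measure_eq_zero_iff_ae_notMem.1 h0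
  filter_upwards [this] with x hx hxV P hP he
  simp only [Set.mem_sdiff, hxV, true_and, not_not, mem_iUnion] at hx
  obtain ⟨Q, hQ, hxQ⟩ := hx
  have hPQ : P = Q := by
    by_contra hne
    exact hxQ.2 P hP hne he
  subst hPQ
  have hd : HasFDerivAt (fun y => P.1 y + P.2) P.1 x := P.1.hasFDerivAt.add_const _
  refine hd.congr_of_eventuallyEq ?_
  filter_upwards [(piece_open hh hV hT P).mem_nhds hxQ] with y hy
  exact piece_eq hs hy

/-- the linear map of a matrix -/
def matL (A : Matrix (Fin 3) (Fin 2) ℝ) : E2 →L[ℝ] (Fin 3 → ℝ) :=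
  LinearMap.toContinuousLinearMap
    { toFun := fun x i => ∑ j, A i j * x j
      map_add' := fun x y => by ext i; simp [mul_add]; ring
      map_smul' := fun r x => by ext i; simp [mul_add]; ring }

lemma matL_apply (A : Matrix (Fin 3) (Fin 2) ℝ) (x : E2) :
    matL A x = fun i => ∑ j, A i j * x j := rfl

lemma clmMat_matL (A : Matrix (Fin 3) (Fin 2) ℝ) : clmMat (matL A) = A := by
  ext i j
  simp [clmMat, matL_apply]

lemma clmMat_smulRight (w : E2 →L[ℝ] ℝ) (b : Fin 3 → ℝ) :
    clmMat (w.smulRight b) = Matrix.vecMulVec b (fun j => w (EuclideanSpace.single j 1)) := by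
  ext i j
  simp [clmMat, Matrix.vecMulVec_apply, mul_comm]

lemma clmMat_add (L M : E2 →L[ℝ] (Fin 3 → ℝ)) : clmMat (L + M) = clmMat L + clmMat M := by
  ext i j
  simp [clmMat]

/-- the functional of a covector -/
def vecL (a : Fin 2 → ℝ) : E2 →L[ℝ] ℝ :=
  LinearMap.toContinuousLinearMap
    { toFun := fun x => ∑ j, a j * x j
      map_add' := fun x y => by simp [mul_add]; ring
      map_smul' := fun r x => by simp [mul_add]; ring }

lemma vecL_single (a : Fin 2 → ℝ) (j) : vecL a (EuclideanSpace.single j 1) = a j := by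
  show ∑ k, a k * _ = _
  simp

lemma clarke_mem (A : Matrix (Fin 3) (Fin 2) ℝ) (b c : Fin 3 → ℝ) (hb : b ≠ 0) (h : E2 → ℝ)
    (x : E2) (M : E2 →L[ℝ] (Fin 3 → ℝ))
    (hM : M ∈ clarkeSubdiff (fun x => matL A x + c + h x • b) x) :
    ∃ w : E2 →L[ℝ] ℝ, M = matL A + w.smulRight b := by
  obtain ⟨i0, hi0⟩ := Function.ne_iff.mp hb
  have hi0 : b i0 ≠ 0 := hi0
  let Pl : (E2 →L[ℝ] ℝ) →ₗ[ℝ] (E2 →L[ℝ] (Fin 3 → ℝ)) :=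
    { toFun := fun w => w.smulRight b
      map_add' := fun w w' => by ext; simp [add_mul]
      map_smul' := fun r w => by ext; simp [mul_assoc] }
  let P : Submodule ℝ (E2 →L[ℝ] (Fin 3 → ℝ)) := LinearMap.range Pl
  have hcl : IsClosed (P : Set (E2 →L[ℝ] (Fin 3 → ℝ))) := Submodule.closed_of_finiteDimensional P
  have hS : M ∈ {M : E2 →L[ℝ] (Fin 3 → ℝ) | M - matL A ∈ P} := by
    refine convexHull_min ?_ ?_ hM
    · rintro B ⟨u, -, hd, hu⟩
      have hc : IsClosed {M : E2 →L[ℝ] (Fin 3 → ℝ) | M - matL A ∈ P} :=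
        hcl.preimage (f := fun M => M - matL A) (by fun_prop)
      refine hc.mem_of_tendsto hu (Eventually.of_forall fun k => ?_)
      have hdk := hd k
      have hh : DifferentiableAt ℝ h (u k) := by
        have h1 : DifferentiableAt ℝ (fun x => (matL A x + c + h x • b) - (matL A x + c)) (u k) :=
          hdk.sub ((matL A).differentiableAt.add_const c)
        simp only [add_sub_cancel_left] at h1
        have h3 := (differentiableAt_pi.1 h1) i0
        have h2 : DifferentiableAt ℝ (fun x => (h x • b) i0 / b i0) (u k) := by
          simp only [div_eq_mul_inv]
          exact h3.mul_const _
        simpa [hi0] using h2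
      have hf : HasFDerivAt (fun x => matL A x + c + h x • b)
          (matL A + (fderiv ℝ h (u k)).smulRight b) (u k) :=
        ((matL A).hasFDerivAt.add_const c).add (hh.hasFDerivAt.smul_const b)
      show _ ∈ P
      rw [hf.fderiv, add_sub_cancel_left]
      exact ⟨fderiv ℝ h (u k), rfl⟩
    · intro X hX Y hY s t hs ht hst
      show _ ∈ P
      have : s • X + t • Y - matL A = s • (X - matL A) + t • (Y - matL A) := by
        have : matL A = s • matL A + t • matL A := by rw [← add_smul, hst, one_smul]
        rw [smul_sub, smul_sub]
        nth_rewrite 1 [this]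
        abel
      rw [this]
      exact P.add_mem (P.smul_mem _ hX) (P.smul_mem _ hY)
  obtain ⟨w, hw⟩ := hS
  refine ⟨w, ?_⟩
  have : w.smulRight b = M - matL A := hw
  rw [this]; abel

lemma affStar_of (A : Matrix (Fin 3) (Fin 2) ℝ) (b c : Fin 3 → ℝ) (hb : trip A b ≠ 0)
    {h : E2 → ℝ} {V : Set E2} {T : Set ((E2 →L[ℝ] ℝ) × ℝ)} (hh : Continuous h)
    (hV : IsOpen V) (hT : T.Finite)
    (hs : ∀ x ∈ V, ∃ P ∈ T, h x = P.1 x + P.2) :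
    AffStar (fun x => matL A x + c + h x • b) V := by
  have hb0 : b ≠ 0 := by rintro rfl; exact hb (by simp [trip])
  have hpos : 0 < ∑ i, b i ^ 2 := by
    obtain ⟨j, hj⟩ := Function.ne_iff.mp hb0
    have hj : b j ≠ 0 := hj
    exact Finset.sum_pos' (fun i _ => sq_nonneg _) ⟨j, Finset.mem_univ _, by positivity⟩
  refine ⟨sel_pa hh hV hT hs _ _ _, Or.inl ⟨by norm_num, trip A b ^ 2 / ∑ i, b i ^ 2,
    by positivity, ?_⟩⟩
  intro x _ M hM
  obtain ⟨w, rfl⟩ := clarke_mem A b c hb0 h x M hM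
  rw [div_le_iff₀ hpos]
  have := det_ge (clmMat (matL A + w.smulRight b)) b
  rwa [clmMat_add, clmMat_matL, clmMat_smulRight, trip_add] at *

/-- a cut-off -/
def IsCut (V : Set E2) (d : E2 → ℝ) : Prop :=
  Continuous d ∧ (∀ x, 0 ≤ d x) ∧ (∃ K, IsCompact K ∧ K ⊆ V ∧ ∀ x ∉ K, d x = 0) ∧
  ∃ T : Set ((E2 →L[ℝ] ℝ) × ℝ), T.Finite ∧ (0, 0) ∈ T ∧ ∀ x, ∃ P ∈ T, d x = P.1 x + P.2

lemma exists_tent (V : Set E2) (hV : IsOpen V) (c : E2) (hc : c ∈ V) :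
    ∃ d, IsCut V d ∧ 0 < d c := by
  obtain ⟨r, hr, hrV⟩ := Metric.isOpen_iff.1 hV c hc
  let ρ : ℝ := r / 4
  have hρ : 0 < ρ := by positivity
  let u : Fin 2 → E2 →L[ℝ] ℝ := fun j => EuclideanSpace.proj j
  let d : E2 → ℝ := fun x => max 0 (min (min (u 0 x + (ρ - c 0)) (-u 0 x + (ρ + c 0)))
    (min (u 1 x + (ρ - c 1)) (-u 1 x + (ρ + c 1))))
  have hu : ∀ j x, u j x = x j := fun j x => rfl
  refine ⟨d, ⟨by fun_prop, fun x => le_max_left _ _,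
    ⟨Metric.closedBall c (r/2), isCompact_closedBall _ _,
      (Metric.closedBall_subset_ball (by linarith)).trans hrV, ?_⟩,
    {(0,0), (u 0, ρ - c 0), (-u 0, ρ + c 0), (u 1, ρ - c 1), (-u 1, ρ + c 1)}, by simp, by simp,
    ?_⟩, ?_⟩
  · intro x hx
    by_contra hne
    apply hx
    have hpos : 0 < d x := lt_of_le_of_ne (le_max_left _ _) (Ne.symm hne)
    simp only [d, lt_max_iff, lt_self_iff_false, false_or, lt_min_iff, hu] at hpos
    obtain ⟨⟨h1, h2⟩, h3, h4⟩ := hpos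
    rw [Metric.mem_closedBall, EuclideanSpace.dist_eq, Fin.sum_univ_two]
    apply Real.sqrt_le_iff.2 ⟨by positivity, ?_⟩
    rw [Real.dist_eq, Real.dist_eq, sq_abs, sq_abs]
    have a1 : (x 0 - c 0)^2 ≤ ρ^2 := by apply sq_le_sq' <;> linarith
    have a2 : (x 1 - c 1)^2 ≤ ρ^2 := by apply sq_le_sq' <;> linarith
    have : ρ^2 = r^2/16 := by simp only [ρ]; ring
    nlinarith [sq_nonneg r]
  · intro x
    simp only [d]
    rcases max_choice 0 (min (min (u 0 x + (ρ - c 0)) (-u 0 x + (ρ + c 0)))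
      (min (u 1 x + (ρ - c 1)) (-u 1 x + (ρ + c 1)))) with h | h
    · exact ⟨(0,0), by simp, by rw [h]; simp⟩
    · rw [h]
      rcases min_choice (min (u 0 x + (ρ - c 0)) (-u 0 x + (ρ + c 0)))
        (min (u 1 x + (ρ - c 1)) (-u 1 x + (ρ + c 1))) with h | h
      · rw [h]
        rcases min_choice (u 0 x + (ρ - c 0)) (-u 0 x + (ρ + c 0)) with h | h
        · exact ⟨(u 0, ρ - c 0), by simp, h⟩
        · exact ⟨(-u 0, ρ + c 0), by simp, h⟩
      · rw [h]
        rcases min_choice (u 1 x + (ρ - c 1)) (-u 1 x + (ρ + c 1)) with h | h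
        · exact ⟨(u 1, ρ - c 1), by simp, h⟩
        · exact ⟨(-u 1, ρ + c 1), by simp, h⟩
  · simp [d, hu, hρ]

lemma exists_cut_pos (V : Set E2) (hV : IsOpen V) (K : Set E2) (hK : IsCompact K) (hKV : K ⊆ V) :
    ∃ d, IsCut V d ∧ ∀ x ∈ K, 0 < d x := by
  refine hK.induction_on (p := fun s => ∃ d, IsCut V d ∧ ∀ x ∈ s, 0 < d x) ?_ ?_ ?_ ?_
  · exact ⟨fun _ => 0, ⟨by fun_prop, fun _ => le_rfl, ⟨∅, by simp⟩, {(0,0)}, by simp, by simp,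
      by simp⟩, by simp⟩
  · rintro s t hst ⟨d, hd, h⟩
    exact ⟨d, hd, fun x hx => h x (hst hx)⟩
  · rintro s t ⟨d, ⟨h1, h2, ⟨K1, h3, h4, h5⟩, T, h6, h7, h8⟩, h9⟩
      ⟨d', ⟨h1', h2', ⟨K1', h3', h4', h5'⟩, T', h6', h7', h8'⟩, h9'⟩
    refine ⟨fun x => max (d x) (d' x), ⟨by fun_prop, fun x => le_max_of_le_left (h2 x),
      ⟨K1 ∪ K1', h3.union h3', union_subset h4 h4', ?_⟩, T ∪ T', h6.union h6', Or.inl h7, ?_⟩, ?_⟩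
    · intro x hx
      simp only [mem_union, not_or] at hx
      simp [h5 x hx.1, h5' x hx.2]
    · intro x
      rcases max_choice (d x) (d' x) with h | h
      · obtain ⟨P, hP, he⟩ := h8 x
        exact ⟨P, Or.inl hP, h.trans he⟩
      · obtain ⟨P, hP, he⟩ := h8' x
        exact ⟨P, Or.inr hP, h.trans he⟩
    · rintro x (hx | hx)
      · exact lt_max_of_lt_left (h9 x hx)
      · exact lt_max_of_lt_right (h9' x hx)
  · intro x hx
    obtain ⟨d, hd, hp⟩ := exists_tent V hV x (hKV hx)
    refine ⟨{y | 0 < d y}, mem_nhdsWithin_of_mem_nhds ?_, d, hd, fun y hy => hy⟩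
    exact (isOpen_lt continuous_const hd.1).mem_nhds hp

lemma exists_cut (V : Set E2) (hV : IsOpen V) (hf : volume V ≠ ⊤) (ε : ℝ≥0∞) (hε : ε ≠ 0) :
    ∃ d, IsCut V d ∧ volume (V ∩ {x | d x = 0}) ≤ ε := by
  obtain ⟨K, hKV, hK, hlt⟩ := hV.measurableSet.exists_isCompact_lt_add hf hε
  obtain ⟨d, hd, hp⟩ := exists_cut_pos V hV K hK hKV
  refine ⟨d, hd, ?_⟩
  have h1 : V ∩ {x | d x = 0} ⊆ V \ K := by
    rintro x ⟨hx, h0⟩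
    refine ⟨hx, fun hxK => ?_⟩
    have := hp x hxK
    have h0 : d x = 0 := h0
    linarith
  refine (measure_mono h1).trans ?_
  rw [measure_sdiff hKV hK.measurableSet.nullMeasurableSet hK.measure_lt_top.ne]
  exact tsub_le_iff_left.2 hlt.le


/-- the sawtooth -/
def saw (lam t : ℝ) : ℝ := min ((1 - lam) * Int.fract t) (lam * (1 - Int.fract t))

lemma saw_cont (lam : ℝ) (hl : lam ∈ Icc (0:ℝ) 1) : Continuous (saw lam) := by
  have : Continuous ((fun s : ℝ => min ((1 - lam) * s) (lam * (1 - s))) ∘ Int.fract) := by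
    apply ContinuousOn.comp_fract''
    · fun_prop
    · simp [hl.1, hl.2]
  exact this

lemma saw_nonneg (lam : ℝ) (hl : lam ∈ Icc (0:ℝ) 1) (t : ℝ) : 0 ≤ saw lam t := by
  have h1 := Int.fract_nonneg t
  have h2 := (Int.fract_lt_one t).le
  exact le_min (mul_nonneg (by linarith [hl.2]) h1) (mul_nonneg hl.1 (by linarith))

lemma saw_lt (lam : ℝ) (t : ℝ) (h : Int.fract t < lam) : saw lam t = (1 - lam) * Int.fract t :=
  min_eq_left (by nlinarith)

lemma saw_ge (lam : ℝ) (t : ℝ) (h : ¬ Int.fract t < lam) :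
    saw lam t = lam * (1 - Int.fract t) :=
  min_eq_right (by push Not at h; nlinarith)

lemma saw_le_one (lam : ℝ) (hl : lam ∈ Icc (0:ℝ) 1) (t : ℝ) : saw lam t ≤ 1 := by
  have h1 := Int.fract_nonneg t
  have h2 := (Int.fract_lt_one t).le
  refine (min_le_left _ _).trans ?_
  nlinarith [hl.1, hl.2]

lemma period_int (g : ℝ → ℝ≥0∞) (hg : Measurable g) (hp : ∀ t (m : ℤ), g (t + m) = g t) (t : ℝ) :
    ∫⁻ θ in Ioc (0:ℝ) 1, g (t + θ) = ∫⁻ θ in Ioc (0:ℝ) 1, g θ := by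
  have h1 : ∫⁻ θ in Ioc (0:ℝ) 1, g (t + θ) = ∫⁻ θ in Ioc t (t+1), g θ := by
    have := (measurePreserving_add_left (volume : Measure ℝ) t).setLIntegral_comp_preimage
      (s := Ioc t (t+1)) measurableSet_Ioc hg
    rw [← this]
    congr 2
    ext θ; simp
  rw [h1]
  have := (isAddFundamentalDomain_Ioc (T := (1:ℝ)) one_pos t).setLIntegral_eq
    (isAddFundamentalDomain_Ioc (T := (1:ℝ)) one_pos 0) g (by
      rintro ⟨y, hy⟩ x
      obtain ⟨m, rfl⟩ := AddSubgroup.mem_zmultiples_iff.1 hy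
      have := hp x m
      simpa [AddSubgroup.vadd_def, add_comm] using this)
  simpa using this

lemma exists_shift (V : Set E2) (t : E2 → ℝ) (ht : Measurable t) (lam : ℝ)
    (hl : lam ∈ Icc (0:ℝ) 1) (α β : ℝ≥0∞) :
    ∃ θ : ℝ, ∫⁻ x in V, (if Int.fract (t x + θ) < lam then α else β) ≤
      volume V * (ENNReal.ofReal (1 - lam) * β + ENNReal.ofReal lam * α) := by
  let g : ℝ → ℝ≥0∞ := fun s => if Int.fract s < lam then α else β
  have hg : Measurable g :=
    Measurable.ite (measurableSet_lt measurable_fract measurable_const) measurable_const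
      measurable_const
  have hgp : ∀ t (m : ℤ), g (t + m) = g t := fun t m => by simp [g]
  have hint : ∫⁻ θ in Ioc (0:ℝ) 1, g θ = ENNReal.ofReal (1 - lam) * β + ENNReal.ofReal lam * α := by
    rw [← restrict_Ico_eq_restrict_Ioc]
    rw [show Ico (0:ℝ) 1 = Ico 0 lam ∪ Ico lam 1 from (Ico_union_Ico_eq_Ico hl.1 hl.2).symm]
    rw [lintegral_union measurableSet_Ico (by
      rw [Set.disjoint_left]; rintro x ⟨_, h⟩ ⟨h', _⟩; linarith)]
    rw [setLIntegral_congr_fun (s := Ico 0 lam) (g := fun _ => α) measurableSet_Ico (by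
      intro x hx
      have : Int.fract x = x := Int.fract_eq_self.2 ⟨hx.1, hx.2.trans_le hl.2⟩
      simp [g, this, hx.2])]
    rw [setLIntegral_congr_fun (s := Ico lam 1) (g := fun _ => β) measurableSet_Ico (by
      intro x hx
      have : Int.fract x = x := Int.fract_eq_self.2 ⟨hl.1.trans hx.1, hx.2⟩
      simp [g, this, hx.1])]
    simp only [setLIntegral_const, Real.volume_Ico, sub_zero]
    ring
  let μ : Measure ℝ := volume.restrict (Ioc 0 1)
  have : IsProbabilityMeasure μ := ⟨by simp [μ]⟩
  have hm : Measurable (Function.uncurry fun (θ : ℝ) (x : E2) => g (t x + θ)) :=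
    hg.comp ((ht.comp measurable_snd).add measurable_fst)
  obtain ⟨θ, hθ⟩ := exists_le_lintegral (μ := μ) (f := fun θ => ∫⁻ x in V, g (t x + θ))
    (hm.lintegral_prod_right').aemeasurable
  refine ⟨θ, hθ.trans ?_⟩
  rw [lintegral_lintegral_swap hm.aemeasurable]
  simp only [μ, period_int g hg hgp, hint, setLIntegral_const]
  rw [mul_comm]

lemma bad_tendsto (V : Set E2) (hV : MeasurableSet V) (hf : volume V ≠ ⊤) (d : E2 → ℝ)
    (hd : Continuous d) :
    Tendsto (fun k : ℕ => volume (V ∩ {x | 0 < d x ∧ d x ≤ 1 / ((k:ℝ)+1)})) atTop (nhds 0) := by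
  have := tendsto_measure_iInter_atTop (μ := (volume : Measure E2))
    (s := fun k : ℕ => V ∩ {x | 0 < d x ∧ d x ≤ 1 / ((k:ℝ)+1)}) (fun k =>
      (hV.inter ((measurableSet_lt measurable_const hd.measurable).inter
        (measurableSet_le hd.measurable measurable_const))).nullMeasurableSet) (by
      intro k l hkl x hx
      refine ⟨hx.1, hx.2.1, hx.2.2.trans ?_⟩
      exact Nat.one_div_le_one_div hkl) ⟨0, measure_ne_top_of_subset inter_subset_left hf⟩
  suffices he : (⋂ k : ℕ, V ∩ {x | 0 < d x ∧ d x ≤ 1 / ((k:ℝ)+1)}) = ∅ by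
    rw [he, measure_empty] at this
    exact this
  ext x
  simp only [mem_iInter, mem_empty_iff_false, iff_false]
  intro h
  have h0 := (h 0).2.1
  obtain ⟨n, hn⟩ := exists_nat_one_div_lt h0
  have := (h n).2.2
  linarith

lemma saw_sel (V : Set E2) (hVb : Bornology.IsBounded V) (aL : E2 →L[ℝ] ℝ) (lam θ κ : ℝ)
    (hκ : 0 < κ) : ∃ T : Set ((E2 →L[ℝ] ℝ) × ℝ), T.Finite ∧ ∀ x ∈ V,
      (Int.fract (κ * aL x + θ) < lam → ∃ c, ((1 - lam) • aL, c) ∈ T ∧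
        saw lam (κ * aL x + θ) / κ = (1 - lam) * aL x + c) ∧
      (¬ Int.fract (κ * aL x + θ) < lam → ∃ c, (-lam • aL, c) ∈ T ∧
        saw lam (κ * aL x + θ) / κ = -lam * aL x + c) := by
  obtain ⟨R, hR⟩ := hVb.exists_norm_le
  let B : ℝ := κ * (‖aL‖ * R) + |θ|
  let I : Set ℤ := Set.Icc ⌊-B⌋ ⌊B⌋
  have hI : I.Finite := Set.finite_Icc _ _
  refine ⟨(fun m : ℤ => ((1 - lam) • aL, (1 - lam) * (θ - m) / κ)) '' I ∪
    (fun m : ℤ => (-lam • aL, lam * (1 - θ + m) / κ)) '' I, (hI.image _).union (hI.image _), ?_⟩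
  intro x hx
  have hb : |κ * aL x + θ| ≤ B := by
    refine (abs_add_le _ _).trans ?_
    refine add_le_add ?_ le_rfl
    rw [abs_mul, abs_of_pos hκ]
    refine mul_le_mul_of_nonneg_left ?_ hκ.le
    exact (aL.le_opNorm x).trans (mul_le_mul_of_nonneg_left (hR x hx) (norm_nonneg _))
  have hm : ⌊κ * aL x + θ⌋ ∈ I :=
    ⟨Int.floor_mono (abs_le.1 hb).1, Int.floor_mono (abs_le.1 hb).2⟩
  constructor
  · intro h
    refine ⟨_, Or.inl ⟨_, hm, rfl⟩, ?_⟩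
    rw [saw_lt _ _ h, Int.fract]
    field_simp
    ring
  · intro h
    refine ⟨_, Or.inr ⟨_, hm, rfl⟩, ?_⟩
    rw [saw_ge _ _ h, Int.fract]
    field_simp
    ring

lemma vnorm_smul_le (r : ℝ) (hr : 0 ≤ r) (b : Fin 3 → ℝ) : vnorm (r • b) = r * vnorm b := by
  unfold vnorm
  simp only [Pi.smul_apply, smul_eq_mul, mul_pow, ← Finset.mul_sum]
  rw [Real.sqrt_mul (sq_nonneg r), Real.sqrt_sq hr]

lemma vnorm_nonneg {k : ℕ} (b : Fin k → ℝ) : 0 ≤ vnorm b := Real.sqrt_nonneg _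

lemma key (W₀ : Matrix (Fin 3) (Fin 2) ℝ → ℝ≥0∞) (hW₀cont : Continuous W₀)
    (hW₀top : ∀ A, W₀ A = ⊤ ↔ crossCols A = 0)
    (V : Set E2) (hVo : IsOpen V) (hVb : Bornology.IsBounded V)
    (A : Matrix (Fin 3) (Fin 2) ℝ) (hA : crossCols A ≠ 0) (i : ℕ) (ε : ℝ) (hε : 0 < ε) :
    ∃ φ : E2 → (Fin 3 → ℝ), PiecewiseAffineOn φ V ∧ Continuous φ ∧
      (∃ K, IsCompact K ∧ K ⊆ V ∧ ∀ x ∉ K, φ x = 0) ∧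
      (∀ x, vnorm (φ x) ≤ ε) ∧
      (∀ c : Fin 3 → ℝ, AffStar (fun x => matL A x + c + φ x) V) ∧
      ∫⁻ x in V, RIter W₀ i (jacMat φ x + A) ≤
        volume V * RIter W₀ (i+1) A + (volume V + W₀ A + 1) * ENNReal.ofReal ε := by
  have hε' : ENNReal.ofReal ε ≠ 0 := by simpa using hε
  have hVf : volume V ≠ ⊤ := hVb.measure_lt_top.ne
  have hWA : W₀ A ≠ ⊤ := fun h => hA ((hW₀top A).1 h)
  have hRA : RIter W₀ (i+1) A ≠ ⊤ := ne_top_of_le_ne_top hWA (RIter_le _ _ _)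
  obtain ⟨a, b, lam, hl, htrip, hlt⟩ := exists_good W₀ hW₀cont i A hA
    (RIter W₀ (i+1) A + ENNReal.ofReal ε) (ENNReal.lt_add_right hRA hε')
  set β := RIter W₀ i (A + Matrix.vecMulVec b (-lam • a)) with hβ
  set α := RIter W₀ i (A + Matrix.vecMulVec b ((1 - lam) • a)) with hα
  obtain ⟨d, ⟨hdc, hd0, ⟨K, hK, hKV, hdK⟩, Td, hTd, hTd0, hTds⟩, hdm⟩ :=
    exists_cut V hVo hVf _ hε'
  have hfin : ∀ w, W₀ (A + Matrix.vecMulVec b w) ≠ ⊤ := by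
    intro w hw
    rw [hW₀top] at hw
    apply htrip
    rw [← trip_add A b w]
    simp [trip, hw]
  let Wd : (E2 →L[ℝ] ℝ) × ℝ → ℝ≥0∞ := fun P =>
    W₀ (A + Matrix.vecMulVec b (fun j => P.1 (EuclideanSpace.single j 1)))
  obtain ⟨C, hC, hCb⟩ : ∃ C : ℝ≥0∞, C ≠ ⊤ ∧ ∀ P ∈ Td, Wd P ≤ C := by
    refine ⟨∑ P ∈ hTd.toFinset, Wd P, ENNReal.sum_ne_top.2 fun P _ => hfin _, fun P hP => ?_⟩
    exact Finset.single_le_sum (f := Wd) (fun _ _ => zero_le) (hTd.mem_toFinset.2 hP)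
  have hb1 : ∀ᶠ k : ℕ in atTop, C * volume (V ∩ {x | 0 < d x ∧ d x ≤ 1 / ((k:ℝ)+1)}) ≤
      ENNReal.ofReal ε := by
    have h1 := ENNReal.Tendsto.const_mul (bad_tendsto V hVo.measurableSet hVf d hdc)
      (Or.inr hC)
    rw [mul_zero] at h1
    exact h1.eventually_le_const (pos_iff_ne_zero.2 hε')
  have hb2 : ∀ᶠ k : ℕ in atTop, 1 / ((k:ℝ)+1) * vnorm b ≤ ε := by
    have h1 := (tendsto_one_div_add_atTop_nhds_zero_nat (𝕜 := ℝ)).mul_const (vnorm b)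
    rw [zero_mul] at h1
    exact h1.eventually_le_const hε
  obtain ⟨k, hk1, hk2⟩ := (hb1.and hb2).exists
  set κ : ℝ := (k:ℝ) + 1 with hκd
  have hκ : 0 < κ := by positivity
  let aL := vecL a
  obtain ⟨θ, hθ⟩ := exists_shift V (fun x => κ * aL x) (by fun_prop) lam hl α β
  obtain ⟨Ts, hTs, hsel⟩ := saw_sel V hVb aL lam θ κ hκ
  let σ : E2 → ℝ := fun x => saw lam (κ * aL x + θ) / κ
  have hσc : Continuous σ := ((saw_cont lam hl).comp (by fun_prop)).div_const _
  have hσ0 : ∀ x, 0 ≤ σ x := fun x => div_nonneg (saw_nonneg lam hl _) hκ.le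
  have hσ1 : ∀ x, σ x ≤ 1 / κ := fun x => div_le_div_of_nonneg_right (saw_le_one lam hl _) hκ.le
  let h : E2 → ℝ := fun x => min (σ x) (d x)
  have hhc : Continuous h := hσc.min hdc
  have hT : (Ts ∪ Td).Finite := hTs.union hTd
  have hs : ∀ x ∈ V, ∃ P ∈ Ts ∪ Td, h x = P.1 x + P.2 := by
    intro x hx
    rcases min_choice (σ x) (d x) with he | he
    · by_cases hfr : Int.fract (κ * aL x + θ) < lam
      · obtain ⟨c, hc, hv⟩ := (hsel x hx).1 hfr
        exact ⟨_, Or.inl hc, he.trans hv⟩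
      · obtain ⟨c, hc, hv⟩ := (hsel x hx).2 hfr
        exact ⟨_, Or.inl hc, he.trans hv⟩
    · obtain ⟨P, hP, hv⟩ := hTds x
      exact ⟨P, Or.inr hP, he.trans hv⟩
  have hh0 : ∀ x, 0 ≤ h x := fun x => le_min (hσ0 x) (hd0 x)
  refine ⟨fun x => h x • b, ?_, by fun_prop, ⟨K, hK, hKV, ?_⟩, ?_, ?_, ?_⟩
  · simpa using sel_pa hhc hVo hT hs 0 0 b
  · intro x hx
    have : h x = 0 := by
      show min _ _ = _
      rw [hdK x hx]; exact min_eq_right (hσ0 x)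
    simp [this]
  · intro x
    rw [vnorm_smul_le _ (hh0 x)]
    refine le_trans ?_ hk2
    exact mul_le_mul_of_nonneg_right ((min_le_left _ _).trans (hσ1 x)) (vnorm_nonneg b)
  · intro c
    exact affStar_of A b c htrip hhc hVo hT hs
  · let Bad : Set E2 := V ∩ {x | 0 < d x ∧ d x ≤ 1 / κ}
    let Z : Set E2 := V ∩ {x | d x = 0}
    have hBadm : MeasurableSet Bad := hVo.measurableSet.inter
      ((measurableSet_lt measurable_const hdc.measurable).inter
        (measurableSet_le hdc.measurable measurable_const))
    have hZm : MeasurableSet Z := hVo.measurableSet.inter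
      (measurableSet_eq_fun hdc.measurable measurable_const)
    let g : E2 → ℝ≥0∞ := fun x => if Int.fract (κ * aL x + θ) < lam then α else β
    have hjac : ∀ (L : E2 →L[ℝ] ℝ) (x : E2), HasFDerivAt h L x →
        jacMat (fun x => h x • b) x + A =
          A + Matrix.vecMulVec b (fun j => L (EuclideanSpace.single j 1)) := by
      intro L x hL
      rw [jacMat, (hL.smul_const b).fderiv, clmMat_smulRight, add_comm]
    have hae : ∀ᵐ x ∂(volume.restrict V), RIter W₀ i (jacMat (fun x => h x • b) x + A) ≤
        g x + (Bad.indicator (fun _ => C) x + Z.indicator (fun _ => W₀ A) x) := by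
      filter_upwards [sel_ae hhc hVo hT hs, ae_restrict_mem hVo.measurableSet] with x hx hxV
      rcases le_or_gt (σ x) (d x) with hle | hgt
      · have he : h x = σ x := min_eq_left hle
        refine le_add_right ?_
        by_cases hfr : Int.fract (κ * aL x + θ) < lam
        · obtain ⟨c, hc, hv⟩ := (hsel x hxV).1 hfr
          rw [hjac _ x (hx _ (Or.inl hc) (he.trans hv))]
          simp only [g, hfr, if_true, hα]
          apply le_of_eq
          congr 3
          ext j
          simp [aL, vecL_single]
        · obtain ⟨c, hc, hv⟩ := (hsel x hxV).2 hfr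
          rw [hjac _ x (hx _ (Or.inl hc) (he.trans hv))]
          simp only [g, hfr, if_false, hβ]
          apply le_of_eq
          congr 3
          ext j
          simp [aL, vecL_single]
      · have he : h x = d x := min_eq_right hgt.le
        refine le_add_left ?_
        by_cases hdx : d x = 0
        · refine le_add_left ?_
          rw [hjac _ x (hx _ (Or.inr hTd0) (by rw [he, hdx]; simp)),
            indicator_of_mem (show x ∈ Z from ⟨hxV, hdx⟩)]
          refine (RIter_le _ _ _).trans (le_of_eq ?_)
          congr 1
          ext r s
          simp [Matrix.vecMulVec_apply]
        · refine le_add_right ?_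
          obtain ⟨P, hP, hv⟩ := hTds x
          rw [hjac _ x (hx _ (Or.inr hP) (he.trans hv)),
            indicator_of_mem (show x ∈ Bad from ⟨hxV, lt_of_le_of_ne (hd0 x) (Ne.symm hdx),
              hgt.le.trans (hσ1 x)⟩)]
          exact (RIter_le _ _ _).trans (hCb P hP)
    refine (lintegral_mono_ae hae).trans ?_
    have hgm : Measurable g := Measurable.ite
      (measurableSet_lt (measurable_fract.comp (by fun_prop)) measurable_const) measurable_const
      measurable_const
    rw [lintegral_add_left hgm, lintegral_add_left (measurable_const.indicator hBadm),
      lintegral_indicator_const hBadm, lintegral_indicator_const hZm]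
    have e1 : (volume.restrict V) Bad ≤ volume Bad := Measure.restrict_apply_le _ _
    have e2 : (volume.restrict V) Z ≤ volume Z := Measure.restrict_apply_le _ _
    calc _ ≤ volume V * (RIter W₀ (i+1) A + ENNReal.ofReal ε) +
          (ENNReal.ofReal ε + W₀ A * ENNReal.ofReal ε) := by
          refine add_le_add (hθ.trans (mul_le_mul_right hlt.le _)) (add_le_add ?_ ?_)
          · exact (mul_le_mul_right e1 C).trans hk1
          · exact mul_le_mul_right (e2.trans hdm) _
      _ = _ := by ring

/-- Belgacem's lemma: oscillating compactly supported piecewise affine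
perturbations realizing the next Kohn–Strang iterate on an arbitrary bounded open set V
with negligible boundary. -/
theorem stmt15
    (p C₁ : ℝ) (hp : 1 < p) (hC₁ : 0 < C₁)
    (W₀ : Matrix (Fin 3) (Fin 2) ℝ → ℝ≥0∞)
    -- W₀ continuous as an extended-valued function
    (hW₀cont : Continuous W₀)
    -- W₀ p-coercive
    (hW₀coer : ∀ A, ENNReal.ofReal (C₁ * mnorm A ^ p - 1 / C₁) ≤ W₀ A)
    -- W₀(A) = +∞ iff A¹ ∧ A² = 0
    (hW₀top : ∀ A, W₀ A = ⊤ ↔ crossCols A = 0)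
    -- p-growth where |A¹ ∧ A²| is bounded away from 0
    (hW₀grow : ∀ δ : ℝ, 0 < δ → ∃ c : ℝ, 0 < c ∧ ∀ A, δ ≤ vnorm (crossCols A) →
      W₀ A ≤ ENNReal.ofReal (c * (1 + mnorm A ^ p)))
    (V : Set (EuclideanSpace ℝ (Fin 2))) (hVo : IsOpen V) (hVb : Bornology.IsBounded V)
    (hVfr : volume (frontier V) = 0)
    (A : Matrix (Fin 3) (Fin 2) ℝ) (hA : A.rank = 2) (i : ℕ) :
    ∃ φ : ℕ → ℕ → ℕ → EuclideanSpace ℝ (Fin 2) → (Fin 3 → ℝ),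
      -- φ_{n,l,q} ∈ Aff_c(V, ℝ³)
      (∀ n l q, PiecewiseAffineOn (φ n l q) V ∧ Continuous (φ n l q) ∧
        ∃ K, IsCompact K ∧ K ⊆ V ∧ ∀ x ∉ K, φ n l q x = 0) ∧
      -- (i) L^p convergence to 0 as n → ∞
      (∀ l q, Tendsto (fun n => ∫⁻ x in V, ENNReal.ofReal (vnorm (φ n l q x) ^ p))
        atTop (nhds 0)) ∧
      -- (ii) x ↦ Ax + c + φ_{n,l,q}(x) ∈ Aff*(V, ℝ³)
      (∀ n l q (c : Fin 3 → ℝ),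
        AffStar (fun x => (fun i' => (∑ j, A i' j * x j) + c i' + φ n l q x i')) V) ∧
      -- (iii)
      (Filter.limsup (fun q => Filter.limsup (fun l => Filter.limsup
          (fun n => ∫⁻ x in V, RIter W₀ i (jacMat (φ n l q) x + A)) atTop) atTop) atTop
        ≤ volume V * RIter W₀ (i+1) A) := by
  have hA' := crossCols_ne A hA
  have hVf : volume V ≠ ⊤ := hVb.measure_lt_top.ne
  have hWA : W₀ A ≠ ⊤ := fun h => hA' ((hW₀top A).1 h)
  have hpos : ∀ n : ℕ, (0:ℝ) < 1 / ((n:ℝ) + 1) := fun n => by positivity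
  choose φ h1 h2 h3 h4 h5 h6 using fun n : ℕ =>
    key W₀ hW₀cont hW₀top V hVo hVb A hA' i (1 / ((n:ℝ) + 1)) (hpos n)
  have ht0 : Tendsto (fun n : ℕ => 1 / ((n:ℝ) + 1)) atTop (nhds 0) :=
    tendsto_one_div_add_atTop_nhds_zero_nat
  refine ⟨fun n _ _ => φ n, fun n _ _ => ⟨h1 n, h2 n, h3 n⟩, fun _ _ => ?_, ?_, ?_⟩
  · have hub : Tendsto (fun n : ℕ => ENNReal.ofReal ((1 / ((n:ℝ) + 1)) ^ p) * volume V) atTop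
        (nhds 0) := by
      have e1 : Tendsto (fun n : ℕ => (1 / ((n:ℝ) + 1)) ^ p) atTop (nhds 0) := by
        have := ht0.rpow_const (p := p) (Or.inr (by linarith))
        rwa [Real.zero_rpow (by linarith)] at this
      have e2 := ENNReal.Tendsto.mul_const (ENNReal.tendsto_ofReal e1) (b := volume V)
        (Or.inr hVf)
      simpa using e2
    refine tendsto_of_tendsto_of_tendsto_of_le_of_le tendsto_const_nhds hub
      (fun _ => zero_le) (fun n => ?_)
    show ∫⁻ x in V, ENNReal.ofReal (vnorm (φ n x) ^ p) ≤ ENNReal.ofReal ((1 / ((n:ℝ) + 1)) ^ p) * volume V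
    rw [← setLIntegral_const]
    refine lintegral_mono fun x => ENNReal.ofReal_le_ofReal ?_
    exact Real.rpow_le_rpow (vnorm_nonneg _) (h4 n x) (by linarith)
  · intro n _ _ c
    exact h5 n c
  · simp only [limsup_const]
    have hub : Tendsto (fun n : ℕ => volume V * RIter W₀ (i+1) A +
        (volume V + W₀ A + 1) * ENNReal.ofReal (1 / ((n:ℝ) + 1))) atTop
        (nhds (volume V * RIter W₀ (i+1) A)) := by
      have e1 := ENNReal.Tendsto.const_mul (ENNReal.tendsto_ofReal ht0)
        (a := volume V + W₀ A + 1) (Or.inr (by simp [hVf, hWA]))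
      have e2 := e1.const_add (volume V * RIter W₀ (i+1) A)
      simpa using e2
    rw [← hub.limsup_eq]
    exact limsup_le_limsup (Eventually.of_forall h6)
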